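/- Let p be prime, n ≥ 1, α ∈ ℝ, λ > 0, and 1 < r, q < ∞. Define f on ℚ_p^n \ {0} by f(x) = |x|_p^{−(α+n/q−λ)}. Then: (i) for every k ∈ ℤ, ‖f χ_k‖_{L^q(ℚ_p^n)} = (1 − p^{−n})^{1/q} p^{k(λ−α)}; and (ii) ‖f‖_{MK̇^{α,λ}_{r,q}} = (1 − p^{−n})^{1/q} · p^{λ} · (p^{rλ} − 1)^{−1/r}. -/

import Mathlib

open MeasureTheory
open scoped ENNReal

noncomputable section

variable (p : ℕ) [Fact p.Prime]

instance padicMeasurableSpace : MeasurableSpace ℚ_[p] := borel _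
instance padicBorelSpace : BorelSpace ℚ_[p] := ⟨rfl⟩

/-- The closed unit ball of `ℚ_[p]` as a positive compact set. -/
def padicUnitBall : TopologicalSpace.PositiveCompacts ℚ_[p] where
  carrier := Metric.closedBall 0 1
  isCompact' := isCompact_closedBall 0 1
  interior_nonempty' :=
    ⟨0, mem_interior_iff_mem_nhds.mpr
      (Filter.mem_of_superset (Metric.ball_mem_nhds 0 one_pos) Metric.ball_subset_closedBall)⟩

/-- Haar measure on `ℚ_[p]` normalized so that `ℤ_p` has measure 1. -/
def padicHaar : Measure ℚ_[p] := Measure.addHaarMeasure (padicUnitBall p)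

instance : SigmaFinite (padicHaar p) := by
  unfold padicHaar; infer_instance

/-- Normalized Haar measure on `ℚ_[p]^n` (the product measure), for which the
unit ball has measure 1. -/
def padicHaarPi (n : ℕ) : Measure (Fin n → ℚ_[p]) := Measure.pi fun _ => padicHaar p

/-- `ℤ_p^* = {t : 0 < |t|_p ≤ 1}`. -/
def Zpstar : Set ℚ_[p] := {t | t ≠ 0 ∧ ‖t‖ ≤ 1}

/-- `(ℤ_p^*)^m`. -/
def ZpstarPi (m : ℕ) : Set (Fin m → ℚ_[p]) := Set.univ.pi fun _ => Zpstar p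

/-- The sphere `S_k = {x ∈ ℚ_p^n : |x|_p = p^k}`. -/
def padicSphere (n : ℕ) (k : ℤ) : Set (Fin n → ℚ_[p]) := {x | ‖x‖ = (p : ℝ) ^ k}

/-- `‖f χ_k‖_{L^q}` for a nonnegative (ℝ≥0∞-valued) function. -/
def lqNormSphere (n : ℕ) (q : ℝ) (k : ℤ) (f : (Fin n → ℚ_[p]) → ℝ≥0∞) : ℝ≥0∞ :=
  (∫⁻ x in padicSphere p n k, f x ^ q ∂ padicHaarPi p n) ^ (1 / q)

/-- The homogeneous p-adic Herz norm `‖f‖_{K̇^{α,r}_q}`. -/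
def herzNorm (n : ℕ) (α r q : ℝ) (f : (Fin n → ℚ_[p]) → ℝ≥0∞) : ℝ≥0∞ :=
  (∑' k : ℤ, (p : ℝ≥0∞) ^ ((k : ℝ) * α * r) * lqNormSphere p n q k f ^ r) ^ (1 / r)

/-- The homogeneous p-adic Morrey–Herz norm `‖f‖_{MK̇^{α,λ}_{r,q}}`. -/
def morreyHerzNorm (n : ℕ) (α lam r q : ℝ) (f : (Fin n → ℚ_[p]) → ℝ≥0∞) : ℝ≥0∞ :=
  ⨆ k₀ : ℤ, (p : ℝ≥0∞) ^ (-(k₀ : ℝ) * lam) *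
    (∑' k : {k : ℤ // k ≤ k₀},
      (p : ℝ≥0∞) ^ (((k : ℤ) : ℝ) * α * r) * lqNormSphere p n q (k : ℤ) f ^ r) ^ (1 / r)

/-- The weighted multilinear p-adic Hardy operator `H^{p,m}_ψ`. -/
def multilinearHardy (n m : ℕ) (ψ : (Fin m → ℚ_[p]) → ℝ≥0∞)
    (f : Fin m → (Fin n → ℚ_[p]) → ℝ≥0∞) (x : Fin n → ℚ_[p]) : ℝ≥0∞ :=
  ∫⁻ t in ZpstarPi p m, (∏ i, f i (t i • x)) * ψ t ∂ padicHaarPi p m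

/-- The dual weighted multilinear p-adic Hardy operator `H^{p,m,*}_ψ`. -/
def multilinearHardyDual (n m : ℕ) (ψ : (Fin m → ℚ_[p]) → ℝ≥0∞)
    (f : Fin m → (Fin n → ℚ_[p]) → ℝ≥0∞) (x : Fin n → ℚ_[p]) : ℝ≥0∞ :=
  ∫⁻ t in ZpstarPi p m,
      (∏ i, f i ((((padicNormE (t i) : ℚ)⁻¹ : ℚ_[p])) • x)) *
        (∏ i, ENNReal.ofReal ‖t i‖ ^ (-(n : ℝ))) * ψ t ∂ padicHaarPi p m


theorem padicHaar_unit_closedBall (p : ℕ) [Fact p.Prime] :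
    padicHaar p (Metric.closedBall 0 1) = 1 :=
  Measure.addHaarMeasure_self (K₀ := padicUnitBall p)

instance (p : ℕ) [Fact p.Prime] : (padicHaar p).IsAddHaarMeasure := by
  unfold padicHaar; infer_instance

theorem Padic.closedBall_zpow_add_one (p : ℕ) [Fact p.Prime] (k : ℤ) :
    Metric.closedBall (0 : ℚ_[p]) ((p : ℝ) ^ (k + 1)) =
      ⋃ i : Fin p, Metric.closedBall ((i : ℕ) * (p : ℚ_[p]) ^ (-(k + 1))) ((p : ℝ) ^ k) := by
  have hp : (0 : ℝ) < p := by exact_mod_cast (Fact.out : p.Prime).pos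
  have hp0 : (p : ℚ_[p]) ≠ 0 := by exact_mod_cast (Fact.out : p.Prime).ne_zero
  ext x
  simp only [Metric.mem_closedBall, Set.mem_iUnion, dist_eq_norm, sub_zero]
  constructor
  · intro hx
    have hy : ‖x * (p : ℚ_[p]) ^ (k + 1)‖ ≤ 1 := by
      rw [norm_mul, Padic.norm_p_zpow, zpow_neg]
      exact mul_inv_le_one_of_le₀ hx (by positivity)
    let y : ℤ_[p] := ⟨x * (p : ℚ_[p]) ^ (k + 1), hy⟩
    refine ⟨⟨y.zmodRepr, y.zmodRepr_lt_p⟩, ?_⟩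
    have h1 : ‖x * (p : ℚ_[p]) ^ (k + 1) - (y.zmodRepr : ℚ_[p])‖ ≤ (p : ℝ) ^ (-1 : ℤ) := by
      rw [Padic.norm_le_pow_iff_norm_lt_pow_add_one]
      have h := y.norm_sub_zmodRepr_lt_one
      rw [PadicInt.norm_def, PadicInt.coe_sub, PadicInt.coe_natCast] at h
      simpa using h
    have h2 : x - (y.zmodRepr : ℚ_[p]) * (p : ℚ_[p]) ^ (-(k + 1)) =
        (x * (p : ℚ_[p]) ^ (k + 1) - (y.zmodRepr : ℚ_[p])) * (p : ℚ_[p]) ^ (-(k + 1)) := by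
      rw [sub_mul, mul_assoc, ← zpow_add₀ hp0]; simp
    rw [h2, norm_mul, Padic.norm_p_zpow, neg_neg]
    calc _ ≤ (p : ℝ) ^ (-1 : ℤ) * (p : ℝ) ^ (k + 1) := by gcongr
      _ = (p : ℝ) ^ k := by rw [← zpow_add₀ hp.ne']; congr 1; ring
  · rintro ⟨i, hi⟩
    have h1 : ‖((i : ℕ) : ℚ_[p]) * (p : ℚ_[p]) ^ (-(k + 1))‖ ≤ (p : ℝ) ^ (k + 1) := by
      rw [norm_mul, Padic.norm_p_zpow, neg_neg]
      exact mul_le_of_le_one_left (by positivity) (by simpa using Padic.norm_int_le_one (p := p) (i : ℕ))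
    have h2 : (p : ℝ) ^ k ≤ (p : ℝ) ^ (k + 1) :=
      zpow_le_zpow_right₀ (by exact_mod_cast (Fact.out : p.Prime).one_le) (by lia)
    calc ‖x‖ = ‖(x - (i : ℕ) * (p : ℚ_[p]) ^ (-(k + 1))) + (i : ℕ) * (p : ℚ_[p]) ^ (-(k + 1))‖ := by
          rw [sub_add_cancel]
      _ ≤ _ := (Padic.nonarchimedean _ _).trans (max_le (hi.trans h2) h1)

theorem Padic.pairwise_disjoint_closedBall_zpow (p : ℕ) [Fact p.Prime] (k : ℤ) :
    Pairwise (Function.onFun Disjoint fun i : Fin p ↦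
      Metric.closedBall ((i : ℕ) * (p : ℚ_[p]) ^ (-(k + 1))) ((p : ℝ) ^ k)) := by
  have hp : (1 : ℝ) < p := by exact_mod_cast (Fact.out : p.Prime).one_lt
  intro i j hij
  refine Set.disjoint_left.mpr fun x hi hj ↦ hij ?_
  rw [Metric.mem_closedBall, dist_eq_norm] at hi hj
  rw [norm_sub_rev] at hi
  have h := (Padic.nonarchimedean _ _).trans (max_le hi hj)
  rw [sub_add_sub_cancel, ← sub_mul, norm_mul, Padic.norm_p_zpow, neg_neg,
    zpow_add_one₀ (by positivity), mul_comm ((p : ℝ) ^ k), ← mul_assoc] at h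
  have h1 : ‖((i : ℕ) : ℚ_[p]) - ((j : ℕ) : ℚ_[p])‖ < 1 := by
    by_contra! h3
    have : (1 : ℝ) * p ≤ 1 := by
      refine le_of_mul_le_mul_right ?_ (show (0 : ℝ) < (p : ℝ) ^ k by positivity)
      rw [one_mul ((p : ℝ) ^ k)]
      refine le_trans ?_ h
      gcongr
    linarith
  have h4 : ‖(((i : ℕ) - (j : ℕ) : ℤ) : ℚ_[p])‖ < 1 := by simpa using h1
  rw [Padic.norm_intCast_lt_one_iff] at h4
  have hi' : ((i : ℕ) : ℤ) < p := by exact_mod_cast i.2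
  have hj' : ((j : ℕ) : ℤ) < p := by exact_mod_cast j.2
  have h5 := Int.eq_zero_of_abs_lt_dvd h4 (by rw [abs_lt]; constructor <;> lia)
  exact Fin.ext (by lia)

theorem padicHaar_closedBall_zpow_add_one (p : ℕ) [Fact p.Prime] (k : ℤ) :
    padicHaar p (Metric.closedBall 0 ((p : ℝ) ^ (k + 1))) =
      p * padicHaar p (Metric.closedBall 0 ((p : ℝ) ^ k)) := by
  rw [Padic.closedBall_zpow_add_one, measure_iUnion (Padic.pairwise_disjoint_closedBall_zpow p k)
    fun _ ↦ Metric.isClosed_closedBall.measurableSet]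
  have h (x : ℚ_[p]) (s : ℝ) :
      padicHaar p (Metric.closedBall x s) = padicHaar p (Metric.closedBall 0 s) := by
    rw [← measure_preimage_add (padicHaar p) x (Metric.closedBall x s)]
    simp
  simp only [h]
  simp

theorem padicHaar_closedBall_zpow (p : ℕ) [Fact p.Prime] (k : ℤ) :
    padicHaar p (Metric.closedBall 0 ((p : ℝ) ^ k)) = (p : ℝ≥0∞) ^ k := by
  have hp0 : (p : ℝ≥0∞) ≠ 0 := by exact_mod_cast (Fact.out : p.Prime).ne_zero
  have hpt : (p : ℝ≥0∞) ≠ ∞ := ENNReal.natCast_ne_top p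
  induction k with
  | zero => simp [padicHaar_unit_closedBall]
  | succ k ih =>
    rw [padicHaar_closedBall_zpow_add_one, ih, ENNReal.zpow_add hp0 hpt, zpow_one, mul_comm]
  | pred k ih =>
    have h := padicHaar_closedBall_zpow_add_one p (-(k : ℤ) - 1)
    rw [sub_add_cancel, ih] at h
    rw [← ENNReal.mul_right_inj hp0 hpt, ← h]
    nth_rw 2 [← zpow_one (p : ℝ≥0∞)]
    rw [← ENNReal.zpow_add hp0 hpt]
    congr 1
    ring

theorem padicHaarPi_closedBall_zpow (p n : ℕ) [Fact p.Prime] (k : ℤ) :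
    padicHaarPi p n (Metric.closedBall 0 ((p : ℝ) ^ k)) = (p : ℝ≥0∞) ^ ((k : ℝ) * n) := by
  rw [closedBall_pi _ (by positivity), padicHaarPi, Measure.pi_pi]
  simp [padicHaar_closedBall_zpow, ENNReal.rpow_mul, ENNReal.rpow_intCast]

theorem padicSphere_eq_diff (p n : ℕ) [Fact p.Prime] (k : ℤ) :
    padicSphere p n k =
      Metric.closedBall 0 ((p : ℝ) ^ k) \ Metric.closedBall 0 ((p : ℝ) ^ (k - 1)) := by
  have hp : (1 : ℝ) < p := by exact_mod_cast (Fact.out : p.Prime).one_lt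
  ext x
  simp only [padicSphere, Set.mem_ofPred_eq, Set.mem_sdiff, Metric.mem_closedBall, dist_zero_right]
  have h : ‖x‖ ≤ (p : ℝ) ^ (k - 1) ↔ ‖x‖ < (p : ℝ) ^ k := by
    rw [pi_norm_le_iff_of_nonneg (by positivity), pi_norm_lt_iff (by positivity)]
    simp [Padic.norm_le_pow_iff_norm_lt_pow_add_one]
  rw [h, not_lt, le_antisymm_iff]

theorem measurableSet_padicSphere (p n : ℕ) [Fact p.Prime] (k : ℤ) :
    MeasurableSet (padicSphere p n k) := by
  rw [padicSphere_eq_diff]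
  exact Metric.isClosed_closedBall.measurableSet.diff Metric.isClosed_closedBall.measurableSet

theorem padicHaarPi_padicSphere (p n : ℕ) [Fact p.Prime] (k : ℤ) :
    padicHaarPi p n (padicSphere p n k) =
      (1 - (p : ℝ≥0∞) ^ (-(n : ℝ))) * (p : ℝ≥0∞) ^ ((k : ℝ) * n) := by
  have hp : (1 : ℝ) < p := by exact_mod_cast (Fact.out : p.Prime).one_lt
  have hp0 : (p : ℝ≥0∞) ≠ 0 := by exact_mod_cast (Fact.out : p.Prime).ne_zero
  have hpt : (p : ℝ≥0∞) ≠ ∞ := ENNReal.natCast_ne_top p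
  have hfin (y : ℝ) : (p : ℝ≥0∞) ^ y ≠ ∞ := ENNReal.rpow_ne_top_of_ne_zero hp0 hpt
  rw [padicSphere_eq_diff, measure_sdiff
    (Metric.closedBall_subset_closedBall (zpow_le_zpow_right₀ hp.le (by lia)))
    Metric.isClosed_closedBall.measurableSet.nullMeasurableSet
    (by rw [padicHaarPi_closedBall_zpow]; exact hfin _),
    padicHaarPi_closedBall_zpow, padicHaarPi_closedBall_zpow,
    ENNReal.sub_mul fun _ _ ↦ hfin _, one_mul, ← ENNReal.rpow_add _ _ hp0 hpt]
  congr 2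
  push_cast
  ring

theorem ENNReal.tsum_int_le_rpow {a : ℝ≥0∞} (ha0 : a ≠ 0) (ha : a ≠ ∞) (s : ℝ) (k₀ : ℤ) :
    ∑' k : {k : ℤ // k ≤ k₀}, a ^ (((k : ℤ) : ℝ) * s) =
      a ^ ((k₀ : ℝ) * s) * (1 - a ^ (-s))⁻¹ := by
  let e : ℕ ≃ {k : ℤ // k ≤ k₀} :=
    { toFun := fun j ↦ ⟨k₀ - j, by lia⟩
      invFun := fun k ↦ (k₀ - k).toNat
      left_inv := fun j ↦ by simp
      right_inv := fun k ↦ Subtype.ext (by have := k.2; simp; lia) }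
  rw [← e.tsum_eq, ← ENNReal.tsum_geometric, ← ENNReal.tsum_mul_left]
  refine tsum_congr fun j ↦ ?_
  rw [← ENNReal.rpow_mul_natCast, ← ENNReal.rpow_add _ _ ha0 ha]
  congr 1
  simp only [e, Equiv.coe_fn_mk]
  push_cast
  ring

/-- Computation of the Morrey–Herz norm of the test function
`f(x) = |x|_p^{-(α+n/q-λ)}` (defined away from the origin). -/
theorem statement12 (p n : ℕ) [Fact p.Prime] (hn : 1 ≤ n)
    (α lam r q : ℝ) (hlam : 0 < lam) (hr : 1 < r) (hq : 1 < q)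
    (f : (Fin n → ℚ_[p]) → ℝ≥0∞)
    (hf : ∀ x : Fin n → ℚ_[p], x ≠ 0 →
        f x = ENNReal.ofReal ‖x‖ ^ (-(α + (n : ℝ) / q - lam))) :
    (∀ k : ℤ, lqNormSphere p n q k f
        = (1 - (p : ℝ≥0∞) ^ (-(n : ℝ))) ^ (1 / q) *
            (p : ℝ≥0∞) ^ ((k : ℝ) * (lam - α))) ∧
      morreyHerzNorm p n α lam r q f
        = (1 - (p : ℝ≥0∞) ^ (-(n : ℝ))) ^ (1 / q) * (p : ℝ≥0∞) ^ lam *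
            ((p : ℝ≥0∞) ^ (r * lam) - 1) ^ (-(1 / r)) := by
  have hp0 : (p : ℝ≥0∞) ≠ 0 := by exact_mod_cast (Fact.out : p.Prime).ne_zero
  have hpt : (p : ℝ≥0∞) ≠ ∞ := ENNReal.natCast_ne_top p
  have hpR : (0 : ℝ) < p := by exact_mod_cast (Fact.out : p.Prime).pos
  have hfin (y : ℝ) : (p : ℝ≥0∞) ^ y ≠ ∞ := ENNReal.rpow_ne_top_of_ne_zero hp0 hpt
  have hq0 : 0 < q := one_pos.trans hq
  have hr0 : 0 < r := one_pos.trans hr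
  have hsphere (k : ℤ) : lqNormSphere p n q k f
      = (1 - (p : ℝ≥0∞) ^ (-(n : ℝ))) ^ (1 / q) *
          (p : ℝ≥0∞) ^ ((k : ℝ) * (lam - α)) := by
    have hconst : ∀ x ∈ padicSphere p n k,
        f x ^ q = (p : ℝ≥0∞) ^ ((k : ℝ) * (-(α + (n : ℝ) / q - lam)) * q) := by
      intro x hx
      have hnorm : ‖x‖ = (p : ℝ) ^ k := hx
      have hx0 : x ≠ 0 := norm_pos_iff.mp (by rw [hnorm]; positivity)
      rw [hf x hx0, hnorm, ← Real.rpow_intCast, ← ENNReal.ofReal_rpow_of_pos hpR,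
        ENNReal.ofReal_natCast, ENNReal.rpow_mul, ENNReal.rpow_mul]
    rw [lqNormSphere, setLIntegral_congr_fun (measurableSet_padicSphere p n k) hconst,
      setLIntegral_const, padicHaarPi_padicSphere, mul_left_comm, ← ENNReal.rpow_add _ _ hp0 hpt,
      ENNReal.mul_rpow_of_nonneg _ _ (by positivity), ← ENNReal.rpow_mul]
    congr 2
    field_simp
    ring
  refine ⟨hsphere, ?_⟩
  have hterm (k : ℤ) : (p : ℝ≥0∞) ^ ((k : ℝ) * α * r) * lqNormSphere p n q k f ^ r =
      ((1 - (p : ℝ≥0∞) ^ (-(n : ℝ))) ^ (1 / q)) ^ r * (p : ℝ≥0∞) ^ ((k : ℝ) * (r * lam)) := by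
    rw [hsphere, ENNReal.mul_rpow_of_nonneg _ _ hr0.le, mul_left_comm,
      ← ENNReal.rpow_mul _ _ r, ← ENNReal.rpow_mul _ _ r, ← ENNReal.rpow_add _ _ hp0 hpt]
    congr 2
    ring
  have hgeom : ((1 - (p : ℝ≥0∞) ^ (-(r * lam)))⁻¹) ^ (1 / r) =
      (p : ℝ≥0∞) ^ lam * ((p : ℝ≥0∞) ^ (r * lam) - 1) ^ (-(1 / r)) := by
    have h : (p : ℝ≥0∞) ^ (r * lam) - 1 =
        (p : ℝ≥0∞) ^ (r * lam) * (1 - (p : ℝ≥0∞) ^ (-(r * lam))) := by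
      rw [ENNReal.mul_sub fun _ _ ↦ hfin _, ← ENNReal.rpow_add _ _ hp0 hpt]
      simp
    rw [h, ENNReal.rpow_neg _ (1 / r), ENNReal.mul_rpow_of_nonneg _ _ (by positivity), ← ENNReal.rpow_mul,
      show r * lam * (1 / r) = lam by field_simp,
      ENNReal.mul_inv (.inr (ENNReal.rpow_ne_top_of_nonneg (by positivity) (by finiteness)))
        (.inl (hfin _)), ← mul_assoc,
      ENNReal.mul_inv_cancel (by simp [ENNReal.rpow_eq_zero_iff, hp0, hpt]) (hfin _), one_mul,
      ENNReal.inv_rpow]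
  have hconst (k₀ : ℤ) : (p : ℝ≥0∞) ^ (-(k₀ : ℝ) * lam) *
      (∑' k : {k : ℤ // k ≤ k₀},
        (p : ℝ≥0∞) ^ (((k : ℤ) : ℝ) * α * r) * lqNormSphere p n q (k : ℤ) f ^ r) ^ (1 / r) =
      (1 - (p : ℝ≥0∞) ^ (-(n : ℝ))) ^ (1 / q) * (p : ℝ≥0∞) ^ lam *
        ((p : ℝ≥0∞) ^ (r * lam) - 1) ^ (-(1 / r)) := by
    simp only [hterm]
    rw [ENNReal.tsum_mul_left, ENNReal.tsum_int_le_rpow hp0 hpt,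
      ENNReal.mul_rpow_of_nonneg _ _ (by positivity), ENNReal.mul_rpow_of_nonneg _ _ (by positivity),
      hgeom, ← ENNReal.rpow_mul _ r, mul_one_div_cancel hr0.ne', ENNReal.rpow_one,
      ← ENNReal.rpow_mul, mul_left_comm, ← mul_assoc ((p : ℝ≥0∞) ^ (-(k₀ : ℝ) * lam)),
      ← ENNReal.rpow_add _ _ hp0 hpt,
      show -(k₀ : ℝ) * lam + k₀ * (r * lam) * (1 / r) = 0 by field_simp; ring,
      ENNReal.rpow_zero, one_mul, mul_assoc]
  rw [morreyHerzNorm]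
  simp only [hconst, ciSup_const]

end
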